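/- Let D=(V,A) be a semicomplete multipartite digraph with color classes V_1,…,V_c. Then there exists a unique ordered partition R_1,…,R_k of V such that: for all 1 ≤ i ≤ k, the induced subdigraph D[R_i] is either a strong component of D or a subset of some color class V_j; no arc goes from R_j to R_i for any 1 ≤ i < j ≤ k; and for each 1 ≤ i < k there exist x_i ∈ R_i and y_i ∈ R_{i+1} with the arc x_i y_i ∈ A. -/

import Mathlib

open Set

variable {V : Type*}

/-- `p` is a directed path (nonempty, vertices pairwise distinct, consecutive
vertices joined by arcs of `A`) all of whose vertices lie in `S`. -/
def IsPathOn (A : V → V → Prop) (S : Set V) (p : List V) : Prop :=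
  p ≠ [] ∧ p.Nodup ∧ p.Chain' A ∧ ∀ v ∈ p, v ∈ S

/-- `p` is a directed path within `S` starting at `x` and ending at `y`. -/
def IsPathFromTo (A : V → V → Prop) (S : Set V) (p : List V) (x y : V) : Prop :=
  IsPathOn A S p ∧ p.head? = some x ∧ p.getLast? = some y

/-- The subdigraph induced on `S` is strong. -/
def StrongOn (A : V → V → Prop) (S : Set V) : Prop :=
  ∀ x ∈ S, ∀ y ∈ S, x ≠ y → ∃ p, IsPathFromTo A S p x y

/-- The subdigraph induced on `S` is `k`-strong: it has at least `k+1` vertices and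
remains strong after deleting any set of at most `k-1` vertices. -/
def KStrongOn (A : V → V → Prop) (k : ℕ) (S : Set V) : Prop :=
  k + 1 ≤ S.ncard ∧ ∀ X : Set V, X ⊆ S → X.ncard ≤ k - 1 → StrongOn A (S \ X)

/-- In a semicomplete multipartite digraph, two vertices lie in the same color class
iff they are equal or there is no arc between them in either direction. -/
def SameClass (A : V → V → Prop) (u v : V) : Prop :=
  u = v ∨ (¬ A u v ∧ ¬ A v u)

/-- `A` is (the arc relation of) a semicomplete multipartite digraph: it is loopless
and the "same color class" relation is transitive (hence an equivalence relation whose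
classes are the color classes: within a class there are no arcs, and between any two
vertices of different classes there is at least one arc). -/
def IsSMD (A : V → V → Prop) : Prop :=
  (∀ v, ¬ A v v) ∧
  ∀ u v w, SameClass A u v → SameClass A v w → SameClass A u w

/-- A digraph is unilaterally connected if any two distinct vertices are joined by a
directed path in one direction or the other. -/
def Unilateral (A : V → V → Prop) : Prop :=
  ∀ x y : V, x ≠ y →
    (∃ p, IsPathFromTo A Set.univ p x y) ∨ (∃ p, IsPathFromTo A Set.univ p y x)

/-- The independence number of a semicomplete multipartite digraph: the maximum size
of a color class. -/
noncomputable def indepNum [Fintype V] (A : V → V → Prop) : ℕ :=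
  Finset.univ.sup fun v : V => {u | SameClass A v u}.ncard

/-- `X` is a 2-separator of `x` and `y`: at most two vertices, avoiding `x` and `y`,
whose removal destroys all `(x,y)`-paths. -/
def IsTwoSep (A : V → V → Prop) (x y : V) (X : Set V) : Prop :=
  X ⊆ ({x, y} : Set V)ᶜ ∧ X.ncard ≤ 2 ∧ ¬ ∃ p, IsPathFromTo A Xᶜ p x y

/-- A separator of `x` and `y` is trivial if it contains all out-neighbors of `x`
or all in-neighbors of `y`. -/
def IsTrivialSep (A : V → V → Prop) (x y : V) (X : Set V) : Prop :=
  {w | A x w} ⊆ X ∨ {w | A w y} ⊆ X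

/-- `T` is a strong component of the subdigraph induced on `S`: a maximal subset of
`S` inducing a strong subdigraph. -/
def IsStrongComponentOn (A : V → V → Prop) (S T : Set V) : Prop :=
  T ⊆ S ∧ StrongOn A T ∧ ∀ U : Set V, T ⊆ U → U ⊆ S → StrongOn A U → U = T

/-- `R 0, …, R (k-1)` is the linear decomposition of the subdigraph induced on `S`:
an ordered partition of `S` into nonempty sets, each of which is a strong component
of the subdigraph induced on `S` or a subset of a single color class, with no arc
from a later part to an earlier one and at least one arc between consecutive parts. -/
def IsLinearDecompOn (A : V → V → Prop) (S : Set V) (k : ℕ) (R : Fin k → Set V) : Prop :=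
  (∀ i, (R i).Nonempty ∧ R i ⊆ S) ∧
  (∀ v ∈ S, ∃! i, v ∈ R i) ∧
  (∀ i, IsStrongComponentOn A S (R i) ∨ ∃ v, R i ⊆ {u | SameClass A v u}) ∧
  (∀ i j : Fin k, i < j → ∀ a ∈ R j, ∀ b ∈ R i, ¬ A a b) ∧
  (∀ i : Fin k, ∀ h : (i : ℕ) + 1 < k, ∃ a ∈ R i, ∃ b ∈ R ⟨(i : ℕ) + 1, h⟩, A a b)

/-- The digraph with arc relation `B` contains a directed cycle. -/
def HasCycle (B : V → V → Prop) : Prop :=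
  ∃ c : List V, 2 ≤ c.length ∧ c.Nodup ∧ c.Chain' B ∧
    ∃ a b, c.head? = some a ∧ c.getLast? = some b ∧ B b a

open Relation in
lemma exists_path_of_reflTransGen {A : V → V → Prop} {x y : V} (h : ReflTransGen A x y) :
    ∃ p : List V, p.Nodup ∧ p.IsChain A ∧ p.head? = some x ∧ p.getLast? = some y ∧
      ∀ v ∈ p, ReflTransGen A x v ∧ ReflTransGen A v y := by
  induction h using ReflTransGen.head_induction_on with
  | refl => exact ⟨[y], by simp, by simp, by simp, by simp, by simp [ReflTransGen.refl]⟩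
  | @head a b hab hby ih =>
    obtain ⟨p, hnd, hch, hhd, hlast, hmem⟩ := ih
    by_cases ha : a ∈ p
    · obtain ⟨s, t, rfl⟩ := List.append_of_mem ha
      refine ⟨a :: t, hnd.sublist (List.sublist_append_right _ _), hch.right_of_append, rfl, ?_, ?_⟩
      · rwa [List.getLast?_append_of_ne_nil _ (List.cons_ne_nil _ _)] at hlast
      · intro v hv
        have := hmem v (List.mem_append_right _ hv)
        exact ⟨.head hab this.1, this.2⟩
    · refine ⟨a :: p, by simp [ha, hnd], ?_, rfl, ?_, ?_⟩
      · rw [List.isChain_cons]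
        refine ⟨fun z hz => ?_, hch⟩
        simp_all
      · cases p with
        | nil => simp at hhd
        | cons c l => rwa [List.getLast?_cons_cons]
      · intro v hv
        rcases List.mem_cons.1 hv with rfl | hv
        · exact ⟨.refl, .head hab hby⟩
        · exact ⟨.head hab (hmem v hv).1, (hmem v hv).2⟩

open Relation in
lemma reflTransGen_of_isChain {A : V → V → Prop} {y : V} :
    ∀ {p : List V} {x : V}, p.IsChain A → p.head? = some x → p.getLast? = some y →
      ReflTransGen A x y
  | [], _, _, h, _ => by simp at h
  | [a], x, _, h, h' => by
    simp only [List.head?_cons, List.getLast?_singleton, Option.some.injEq] at h h'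
    rw [← h, ← h']
  | a :: b :: l, x, hc, h, h' => by
    simp only [List.head?_cons, Option.some.injEq] at h
    rw [List.isChain_cons_cons] at hc
    rw [List.getLast?_cons_cons] at h'
    exact h ▸ .head hc.1 (reflTransGen_of_isChain hc.2 rfl h')

open Relation in
lemma StrongOn.reflTransGen {A : V → V → Prop} {S : Set V} (h : StrongOn A S) {x y : V}
    (hx : x ∈ S) (hy : y ∈ S) : ReflTransGen A x y := by
  by_cases hxy : x = y
  · rw [hxy]
  · obtain ⟨p, ⟨-, -, hc, -⟩, hh, hl⟩ := h x hx y hy hxy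
    exact reflTransGen_of_isChain hc hh hl

lemma SameClass.symm {A : V → V → Prop} {u v : V} (h : SameClass A u v) : SameClass A v u :=
  h.imp Eq.symm And.symm

namespace IsSMD

variable {A : V → V → Prop}

lemma not_sameClass_of_adj (hA : IsSMD A) {u v : V} (h : A u v) : ¬ SameClass A u v := by
  rintro (rfl | h')
  · exact hA.1 _ h
  · exact h'.1 h

lemma adj_of_sameClass_left (hA : IsSMD A) {a a' b : V} (haa : SameClass A a a') (h : A a b)
    (hba : ¬ A b a') : A a' b := by
  by_contra hab
  exact hA.not_sameClass_of_adj h (hA.2 _ _ _ haa (.inr ⟨hab, hba⟩))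

lemma adj_of_sameClass_right (hA : IsSMD A) {a b b' : V} (hbb : SameClass A b b') (h : A a b)
    (hba : ¬ A b' a) : A a b' := by
  by_contra hab
  exact hA.not_sameClass_of_adj h (hA.2 _ _ _ (.inr ⟨hab, hba⟩) hbb.symm)

open Relation

/-- If neither of `v` and `w` is reachable from the other, then every vertex other than `w` that is
reachable from `w` is also reachable from `v`. -/
lemma reach_of_incomparable (hA : IsSMD A) {u v w : V} (hwu : ReflTransGen A w u) (hne : w ≠ u)
    (hwv : ¬ ReflTransGen A w v) (hvw : ¬ ReflTransGen A v w) : ReflTransGen A v u := by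
  obtain rfl | ⟨x, hwx, hxu⟩ := hwu.cases_head
  · exact absurd rfl hne
  have hxv : ¬ A x v := fun h => hwv (.head hwx (.single h))
  have hc : SameClass A w v := .inr ⟨fun h => hwv (.single h), fun h => hvw (.single h)⟩
  exact .head (hA.adj_of_sameClass_left hc hwx hxv) hxu

lemma reach_weak_trans (hA : IsSMD A) {u v w : V}
    (huv : ReflTransGen A v u → ReflTransGen A u v)
    (hvw : ReflTransGen A w v → ReflTransGen A v w)
    (hwu : ReflTransGen A w u) : ReflTransGen A u w := by
  by_contra h
  by_cases h1 : ReflTransGen A u v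
  · exact h (h1.trans (hvw (hwu.trans h1)))
  · have h2 : ¬ ReflTransGen A v u := fun h' => h1 (huv h')
    have h3 : ¬ ReflTransGen A v w := fun h' => h2 (h'.trans hwu)
    have h4 : ¬ ReflTransGen A w v := fun h' => h3 (hvw h')
    exact h2 (hA.reach_of_incomparable hwu (fun e => h (e ▸ .refl)) h4 h3)

/-- The vertices preordered by: everything reaching back is reached. -/
abbrev weakPreorder (hA : IsSMD A) : Preorder V where
  le u v := ReflTransGen A v u → ReflTransGen A u v
  le_refl _ := id
  le_trans _ _ _ huv hvw := hA.reach_weak_trans huv hvw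

lemma exists_rank [Fintype V] (hA : IsSMD A) : ∃ (k : ℕ) (r : V → Fin k),
    Function.Surjective r ∧
    ∀ u v, r u < r v ↔ ReflTransGen A u v ∧ ¬ ReflTransGen A v u := by
  classical
  let _ := hA.weakPreorder
  have : @Std.Total V (· ≤ ·) := ⟨fun u v => by
    change (ReflTransGen A v u → ReflTransGen A u v) ∨ (ReflTransGen A u v → ReflTransGen A v u)
    tauto⟩
  have : Finite (Antisymmetrization V (· ≤ ·)) := Quotient.finite _
  have := Fintype.ofFinite (Antisymmetrization V (· ≤ ·))
  let e := Fintype.orderIsoFinOfCardEq (Antisymmetrization V (· ≤ ·)) rfl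
  refine ⟨_, fun v => e.symm (toAntisymmetrization (· ≤ ·) v),
    e.symm.surjective.comp Quotient.mk_surjective, fun u v => ?_⟩
  rw [OrderIso.lt_iff_lt, toAntisymmetrization_lt_toAntisymmetrization_iff, lt_iff_le_not_ge]
  change (ReflTransGen A v u → ReflTransGen A u v) ∧
    ¬ (ReflTransGen A u v → ReflTransGen A v u) ↔ _
  tauto

lemma isLinearDecompOn_fibers {k : ℕ} (hA : IsSMD A) {r : V → Fin k}
    (hs : Function.Surjective r)
    (hr : ∀ u v, r u < r v ↔ ReflTransGen A u v ∧ ¬ ReflTransGen A v u) :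
    IsLinearDecompOn A Set.univ k (fun i => {v | r v = i}) := by
  have hmono : ∀ {u v}, ReflTransGen A u v → r u ≤ r v := fun {u v} h =>
    not_lt.1 fun h' => ((hr v u).1 h').2 h
  refine ⟨fun i => ⟨hs i, Set.subset_univ _⟩, fun v _ => ⟨r v, rfl, fun _ h => h.symm⟩, ?_, ?_, ?_⟩
  · intro i
    have hcomp : ∀ {u v}, r u = i → r v = i → ReflTransGen A u v → ReflTransGen A v u :=
      fun {u v} hu hv h => by
        by_contra h'
        exact ((hr u v).2 ⟨h, h'⟩).ne (hu.trans hv.symm)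
    obtain ⟨z, hz⟩ := hs i
    by_cases hex : ∃ v w, r v = i ∧ r w = i ∧ v ≠ w ∧ ReflTransGen A v w
    · left
      obtain ⟨v, w, hv, hw, hne, hvw⟩ := hex
      have hall : ∀ {x}, r x = i → ReflTransGen A v x ∧ ReflTransGen A x v := fun {x} hx => by
        by_cases h1 : ReflTransGen A v x
        · exact ⟨h1, hcomp hv hx h1⟩
        · have h2 : ¬ ReflTransGen A x v := fun h => h1 (hcomp hx hv h)
          exact absurd ((hA.reach_of_incomparable hvw hne h1 h2).trans (hcomp hv hw hvw)) h2
      refine ⟨Set.subset_univ _, fun x hx y hy hxy => ?_, fun U hU _ hUs => ?_⟩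
      · obtain ⟨p, hnd, hc, hh, hl, hm⟩ :=
          exists_path_of_reflTransGen ((hall hx).2.trans (hall hy).1)
        refine ⟨p, ⟨⟨?_, hnd, hc, fun a ha => ?_⟩, hh, hl⟩⟩
        · rintro rfl
          simp at hh
        · exact le_antisymm ((hmono (hm a ha).2).trans_eq hy)
            ((Eq.symm hx).trans_le (hmono (hm a ha).1))
      · refine Set.Subset.antisymm (fun x hx => ?_) hU
        exact (le_antisymm (hmono (hUs.reflTransGen hx (hU hv)))
          (hmono (hUs.reflTransGen (hU hv) hx))).trans hv
    · right
      refine ⟨z, fun x hx => ?_⟩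
      by_cases hzx : z = x
      · exact .inl hzx
      · exact .inr ⟨fun h => hex ⟨z, x, hz, hx, hzx, .single h⟩,
          fun h => hex ⟨x, z, hx, hz, Ne.symm hzx, .single h⟩⟩
  · rintro i j hij a rfl b rfl h
    exact (hmono (.single h)).not_gt hij
  · intro i h
    obtain ⟨u, hu⟩ := hs i
    obtain ⟨v, hv⟩ := hs ⟨i + 1, h⟩
    have huv : ReflTransGen A u v := ((hr u v).1 (by simp [hu, hv, Fin.lt_def])).1
    induction huv using ReflTransGen.head_induction_on with
    | refl =>
      rw [hu] at hv
      simp [Fin.ext_iff] at hv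
    | @head a b hab hbv ih =>
      by_cases hb : r b = i
      · exact ih hb
      · refine ⟨a, hu, b, ?_, hab⟩
        have h1 := hmono (.single hab)
        have h2 := hmono hbv
        simp only [Set.mem_ofPred_eq, hu, hv, Fin.le_def, Fin.ext_iff] at *
        omega

end IsSMD

namespace IsLinearDecompOn

open Relation

variable {A : V → V → Prop} {k : ℕ} {R : Fin k → Set V}

lemma exists_index (h : IsLinearDecompOn A Set.univ k R) :
    ∃ r : V → Fin k, Function.Surjective r ∧ ∀ i, R i = {v | r v = i} := by
  choose r hr using fun v => h.2.1 v trivial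
  have hR : ∀ i, R i = {v | r v = i} := fun i => Set.ext fun v =>
    ⟨fun hv => ((hr v).2 i hv).symm, fun hv => (show r v = i from hv) ▸ (hr v).1⟩
  refine ⟨r, fun i => ?_, hR⟩
  obtain ⟨v, hv⟩ := (h.1 i).1
  exact ⟨v, by rwa [hR] at hv⟩

lemma sameClass_or_reach (hA : IsSMD A) (h : IsLinearDecompOn A Set.univ k R) {i : Fin k}
    {u v : V} (hu : u ∈ R i) (hv : v ∈ R i) : ReflTransGen A u v ∨ SameClass A u v := by
  obtain hs | ⟨z, hz⟩ := h.2.2.1 i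
  · exact .inl (hs.2.1.reflTransGen hu hv)
  · exact .inr (hA.2 _ _ _ (hz hu).symm (hz hv))

lemma reach_succ (hA : IsSMD A) (h : IsLinearDecompOn A Set.univ k R) {i : Fin k}
    (hi : (i : ℕ) + 1 < k) {u v : V} (hu : u ∈ R i) (hv : v ∈ R ⟨i + 1, hi⟩) :
    ReflTransGen A u v := by
  obtain ⟨a, ha, b, hb, hab⟩ := h.2.2.2.2 i hi
  have hno : ∀ {x y}, x ∈ R i → y ∈ R ⟨i + 1, hi⟩ → ¬ A y x := fun {x y} hx hy =>
    h.2.2.2.1 i ⟨i + 1, hi⟩ (by simp [Fin.lt_def]) y hy x hx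
  obtain ⟨a', ha', hua, hab'⟩ : ∃ a' ∈ R i, ReflTransGen A u a' ∧ A a' b := by
    obtain hua | hua := sameClass_or_reach hA h hu ha
    · exact ⟨a, ha, hua, hab⟩
    · exact ⟨u, hu, .refl, hA.adj_of_sameClass_left hua.symm hab (hno hu hb)⟩
  obtain hbv | hbv := sameClass_or_reach hA h hb hv
  · exact hua.trans (.head hab' hbv)
  · exact hua.tail (hA.adj_of_sameClass_right hbv hab' (hno ha' hv))

lemma index_lt_iff (hA : IsSMD A) (h : IsLinearDecompOn A Set.univ k R) {r : V → Fin k}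
    (hs : Function.Surjective r) (hR : ∀ i, R i = {v | r v = i}) (u v : V) :
    r u < r v ↔ ReflTransGen A u v ∧ ¬ ReflTransGen A v u := by
  have hmem : ∀ x, x ∈ R (r x) := fun x => by simp [hR]
  have hmono : ∀ {u v}, ReflTransGen A u v → r u ≤ r v := fun {u v} h' => by
    induction h' with
    | refl => exact le_rfl
    | @tail b c _ hbc ih =>
      exact ih.trans (not_lt.1 fun hlt => h.2.2.2.1 _ _ hlt b (hmem b) c (hmem c) hbc)
  have hreach : ∀ (n : ℕ) (v : V), (r v : ℕ) = n → r u < r v → ReflTransGen A u v := by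
    intro n
    induction n with
    | zero => intro v hv hlt; simp [Fin.lt_def, hv] at hlt
    | succ m ih =>
      intro v hv hlt
      have hm : m + 1 < k := hv ▸ (r v).2
      obtain ⟨w, hw⟩ := hs ⟨m, by omega⟩
      have hwm : (r w : ℕ) = m := by rw [hw]
      have hwv : ∀ x, (r x : ℕ) = m → ReflTransGen A x v := fun x hx => by
        refine reach_succ hA h (i := r x) (by omega) (hmem x) ?_
        simp [hR, Fin.ext_iff, hv, hx]
      by_cases hum : (r u : ℕ) = m
      · exact hwv u hum
      · refine (ih w hwm ?_).trans (hwv w hwm)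
        rw [Fin.lt_def] at *
        omega
  refine ⟨fun hlt => ⟨hreach _ v rfl hlt, fun h' => (hmono h').not_gt hlt⟩, ?_⟩
  rintro ⟨huv, hvu⟩
  refine lt_of_le_of_ne (hmono huv) fun heq => ?_
  obtain rfl | ⟨x, hux, hxv⟩ := huv.cases_head
  · exact hvu .refl
  have hx : r u = r x := le_antisymm (hmono (.single hux)) (heq ▸ hmono hxv)
  obtain hs | ⟨z, hz⟩ := h.2.2.1 (r u)
  · exact hvu (hs.2.1.reflTransGen (heq ▸ hmem v) (hmem u))
  · exact hA.not_sameClass_of_adj hux (hA.2 _ _ _ (hz (hmem u)).symm (hz (hx ▸ hmem x)))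

end IsLinearDecompOn

lemma surjective_fin_val_le {k k' : ℕ} {r : V → Fin k} {r' : V → Fin k'}
    (hs : Function.Surjective r) (h : ∀ u v, r u < r v → r' u < r' v) (v : V) :
    (r v : ℕ) ≤ r' v := by
  suffices ∀ (n : ℕ) (v : V), (r v : ℕ) = n → n ≤ r' v from this _ v rfl
  intro n
  induction n with
  | zero => simp
  | succ m ih =>
    intro v hv
    obtain ⟨u, hu⟩ := hs ⟨m, by have := (r v).2; omega⟩
    have hum : (r u : ℕ) = m := by rw [hu]
    have h1 : (r' u : ℕ) < r' v := h u v (by rw [Fin.lt_def]; omega)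
    have := ih u hum
    omega

lemma surjective_fin_le {k k' : ℕ} {r : V → Fin k} {r' : V → Fin k'}
    (hs : Function.Surjective r) (h : ∀ u v, r u < r v → r' u < r' v) : k ≤ k' := by
  cases k with
  | zero => exact Nat.zero_le _
  | succ n =>
    obtain ⟨v, hv⟩ := hs (Fin.last n)
    have h1 := surjective_fin_val_le hs h v
    rw [hv, Fin.val_last] at h1
    have := (r' v).2
    omega

/-- Every semicomplete multipartite digraph has a unique linear
decomposition: an ordered partition `R 0, …, R (k-1)` of its vertex set such that
each part induces a strong component or is a subset of a color class, no arc goes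
from a later part to an earlier one, and consecutive parts are joined by an arc. -/
theorem stmt_10 {V : Type*} [Fintype V] (A : V → V → Prop) (hSMD : IsSMD A) :
    ∃ (k : ℕ) (R : Fin k → Set V), IsLinearDecompOn A Set.univ k R ∧
      ∀ (k' : ℕ) (R' : Fin k' → Set V), IsLinearDecompOn A Set.univ k' R' →
        ∃ h : k' = k, ∀ i : Fin k', R' i = R (Fin.cast h i) := by
  obtain ⟨k, r, hs, hr⟩ := hSMD.exists_rank
  refine ⟨k, fun i => {v | r v = i}, hSMD.isLinearDecompOn_fibers hs hr, fun k' R' hR' => ?_⟩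
  obtain ⟨r', hs', hRr⟩ := hR'.exists_index
  have hr' := hR'.index_lt_iff hSMD hs' hRr
  have h1 : ∀ u v, r u < r v → r' u < r' v := fun u v => by rw [hr, hr']; exact id
  have h2 : ∀ u v, r' u < r' v → r u < r v := fun u v => by rw [hr, hr']; exact id
  refine ⟨le_antisymm (surjective_fin_le hs' h2) (surjective_fin_le hs h1), fun i => ?_⟩
  ext v
  have := le_antisymm (surjective_fin_val_le hs h1 v) (surjective_fin_val_le hs' h2 v)
  simp [hRr, Fin.ext_iff, this]
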